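/- Let N ≥ 4 and 1 ≤ k < N − 2 be integers, let Γ ⊂ ℝ^N be a smooth compact embedded k-dimensional submanifold without boundary contained in a smooth domain Ω, and let q ∈ C²(Ω̄) with 0 ≤ q in Ω and q ≤ 1 on Γ. Set δ(x) := dist(x, Γ) and Γ_β := {x ∈ Ω : δ(x) < β}. Let 1 ≤ p < (N−k+2)/(N−k−2). Then for all sufficiently small β > 0 there exists a function u ∈ L^p(Γ_β), smooth and positive on Γ_β \ Γ, such that −Δu(x) − ((N−k−2)²/4) δ(x)^{−2} q(x) u(x) ≥ u(x)^p for every x ∈ Γ_β \ Γ. -/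

import Mathlib

open MeasureTheory Metric Filter
open scoped Topology ENNReal NNReal RealInnerProductSpace

noncomputable section

/-- `ℝ^N` as a Euclidean space. -/
abbrev Euc (N : ℕ) : Type := EuclideanSpace ℝ (Fin N)

/-- `φ ∈ C_c^∞(Ω)`: smooth functions with compact support contained in `Ω`. -/
def IsTestFun {N : ℕ} (Ω : Set (Euc N)) (φ : Euc N → ℝ) : Prop :=
  ContDiff ℝ (⊤ : ℕ∞) φ ∧ HasCompactSupport φ ∧ tsupport φ ⊆ Ω

/-- The classical Laplacian of `φ` at `x`: the sum of the pure second partial derivatives. -/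
def lap {N : ℕ} (φ : Euc N → ℝ) (x : Euc N) : ℝ :=
  ∑ i : Fin N, iteratedFDeriv ℝ 2 φ x ![EuclideanSpace.single i 1, EuclideanSpace.single i 1]

/-- A smooth domain of `ℝ^N`: a nonempty open connected set whose boundary is, near each of
its points, the zero set of a smooth function with non-vanishing differential, the domain
being the corresponding sublevel set. -/
def IsSmoothDomain {N : ℕ} (Ω : Set (Euc N)) : Prop :=
  IsOpen Ω ∧ Ω.Nonempty ∧ IsConnected Ω ∧
    ∀ x ∈ frontier Ω, ∃ (U : Set (Euc N)) (f : Euc N → ℝ),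
      IsOpen U ∧ x ∈ U ∧ ContDiff ℝ (⊤ : ℕ∞) f ∧ (∀ y ∈ U, fderiv ℝ f y ≠ 0) ∧
      Ω ∩ U = {y ∈ U | f y < 0} ∧ frontier Ω ∩ U = {y ∈ U | f y = 0}

/-- A smooth compact embedded `k`-dimensional submanifold of `ℝ^N` without boundary:
a nonempty compact set which is locally the zero set of a smooth submersion into `ℝ^{N-k}`. -/
def IsSmoothSubmanifold (N k : ℕ) (Γ : Set (Euc N)) : Prop :=
  IsCompact Γ ∧ Γ.Nonempty ∧
    ∀ x ∈ Γ, ∃ (U : Set (Euc N)) (f : Euc N → Euc (N - k)),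
      IsOpen U ∧ x ∈ U ∧ ContDiff ℝ (⊤ : ℕ∞) f ∧
      (∀ y ∈ U, Function.Surjective ⇑(fderiv ℝ f y)) ∧
      Γ ∩ U = {y ∈ U | f y = 0}

/-- `δ(x) = dist(x, Γ)`, the distance to `Γ`. -/
def distG {N : ℕ} (Γ : Set (Euc N)) (x : Euc N) : ℝ := Metric.infDist x Γ

/-- The tube `Γ_β = {x ∈ Ω : dist(x, Γ) < β}` around `Γ` inside `Ω`. -/
def tube {N : ℕ} (Ω Γ : Set (Euc N)) (β : ℝ) : Set (Euc N) :=
  {x ∈ Ω | distG Γ x < β}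

/-- Lagrange multiplier rule in a convenient form. -/
theorem lagr {E F : Type*} [NormedAddCommGroup E] [InnerProductSpace ℝ E] [FiniteDimensional ℝ E]
    [NormedAddCommGroup F] [NormedSpace ℝ F] [FiniteDimensional ℝ F]
    {f : E → F} {Γ U : Set E} (hf : ContDiff ℝ (⊤ : ℕ∞) f) (hU : IsOpen U) {σ : E} (hσU : σ ∈ U)
    (hσ : σ ∈ Γ) (hΓU : Γ ∩ U = {y ∈ U | f y = 0})
    (hs : Function.Surjective ⇑(fderiv ℝ f σ))
    {φ : E → ℝ} {φ' : StrongDual ℝ E} (hφ : HasStrictFDerivAt φ φ' σ)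
    (hext : IsLocalExtrOn φ Γ σ) (v : E) (hv : fderiv ℝ f σ v = 0) : φ' v = 0 := by
  have hfσ : f σ = 0 := by
    have : σ ∈ Γ ∩ U := ⟨hσ, hσU⟩
    rw [hΓU] at this
    exact this.2
  have hnh : 𝓝[{x | f x = f σ}] σ = 𝓝[Γ] σ := by
    apply nhdsWithin_eq_nhdsWithin hσU hU
    rw [hΓU, hfσ]
    ext y; simp [and_comm]
  have hext' : IsLocalExtrOn φ {x | f x = f σ} σ := by
    unfold IsLocalExtrOn at hext ⊢
    rwa [hnh]
  have hfs : HasStrictFDerivAt f (fderiv ℝ f σ) σ :=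
    hf.contDiffAt.hasStrictFDerivAt (by simp)
  obtain ⟨Λ, Λ₀, hne, h⟩ := hext'.exists_linear_map_of_hasStrictFDerivAt hfs hφ
  have h0 : Λ₀ ≠ 0 := by
    rintro rfl
    apply hne
    have : Λ = 0 := by
      ext w
      obtain ⟨z, rfl⟩ := hs w
      simpa using h z
    simp [this]
  have := h v
  rw [hv] at this
  simpa [h0] using this

/-- Intrinsic tangent space. -/
def tang {N : ℕ} (Γ : Set (Euc N)) (σ : Euc N) : Submodule ℝ (Euc N) where
  carrier := {v | ∀ g : Euc N → ℝ, ContDiff ℝ (⊤ : ℕ∞) g → (∀ᶠ y in 𝓝[Γ] σ, g y = 0) →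
    fderiv ℝ g σ v = 0}
  zero_mem' := by intro g _ _; simp
  add_mem' := by
    intro a b ha hb g h1 h2
    rw [map_add, ha g h1 h2, hb g h1 h2, add_zero]
  smul_mem' := by
    intro c a ha g h1 h2
    rw [map_smul, ha g h1 h2, smul_zero]

/-- Normal projection. -/
def PN {N : ℕ} (Γ : Set (Euc N)) (σ : Euc N) : Euc N →L[ℝ] Euc N := (tang Γ σ)ᗮ.starProjection

theorem tang_eq {N m : ℕ} {f : Euc N → Euc m} {Γ U : Set (Euc N)} (hf : ContDiff ℝ (⊤ : ℕ∞) f)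
    (hU : IsOpen U) {σ : Euc N} (hσU : σ ∈ U)
    (hσ : σ ∈ Γ) (hΓU : Γ ∩ U = {y ∈ U | f y = 0})
    (hs : Function.Surjective ⇑(fderiv ℝ f σ)) (v : Euc N) :
    v ∈ tang Γ σ ↔ fderiv ℝ f σ v = 0 := by
  constructor
  · intro hv
    have hv' : ∀ g : Euc N → ℝ, ContDiff ℝ (⊤ : ℕ∞) g → (∀ᶠ y in 𝓝[Γ] σ, g y = 0) →
      fderiv ℝ g σ v = 0 := hv
    have hfd : HasFDerivAt f (fderiv ℝ f σ) σ := (hf.differentiable (by simp) σ).hasFDerivAt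
    ext i
    have h1 := hv' (fun y => EuclideanSpace.proj (𝕜 := ℝ) i (f y))
      ((EuclideanSpace.proj (𝕜 := ℝ) i).contDiff.comp hf) (by
        have : U ∈ 𝓝[Γ] σ := mem_nhdsWithin_of_mem_nhds (hU.mem_nhds hσU)
        filter_upwards [this, self_mem_nhdsWithin] with y hy hyΓ
        have h2 : y ∈ Γ ∩ U := ⟨hyΓ, hy⟩
        rw [hΓU] at h2
        rw [h2.2]; simp)
    have h3 : HasFDerivAt (fun y => EuclideanSpace.proj (𝕜 := ℝ) i (f y)) _ σ :=
      (EuclideanSpace.proj (𝕜 := ℝ) i).hasFDerivAt.comp σ hfd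
    rw [h3.fderiv] at h1
    simpa using h1
  · intro hv g hg h0
    have hgσ : g σ = 0 := h0.self_of_nhdsWithin hσ
    refine lagr hf hU hσU hσ hΓU hs (hg.contDiffAt.hasStrictFDerivAt (by simp)) ?_ v hv
    left
    filter_upwards [h0] with y hy
    rw [hy, hgσ]

theorem PN_nearest {N k : ℕ} {Γ : Set (Euc N)} (hΓ : IsSmoothSubmanifold N k Γ) {σ x : Euc N}
    (hσ : σ ∈ Γ) (hx : infDist x Γ = dist x σ) : PN Γ σ (x - σ) = x - σ := by
  unfold PN
  rw [Submodule.starProjection_eq_self_iff, Submodule.mem_orthogonal]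
  intro v hv
  obtain ⟨U, f, hU, hσU, hf, hs, hΓU⟩ := hΓ.2.2 σ hσ
  rw [tang_eq hf hU hσU hσ hΓU (hs σ hσU)] at hv
  have hd : HasStrictFDerivAt (fun y : Euc N => ‖y - x‖ ^ 2) (2 • (innerSL ℝ (σ - x))) σ := by
    have := (hasStrictFDerivAt_norm_sq (σ - x)).comp σ ((hasStrictFDerivAt_id σ).sub_const x)
    simpa using this
  have := lagr hf hU hσU hσ hΓU (hs σ hσU) hd (by
    left
    filter_upwards [self_mem_nhdsWithin] with y hy
    have h1 : dist x σ ≤ dist x y := hx ▸ infDist_le_dist_of_mem hy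
    rw [dist_comm x σ, dist_comm x y, dist_eq_norm, dist_eq_norm] at h1
    gcongr) v hv
  have h2 : ⟪σ - x, v⟫ = 0 := by rw [inner_sub_left]; simpa using this
  rw [real_inner_comm, ← neg_sub, inner_neg_left, h2, neg_zero]

theorem PN_trace {N k : ℕ} (hk : k ≤ N) {Γ : Set (Euc N)} (hΓ : IsSmoothSubmanifold N k Γ)
    {σ : Euc N} (hσ : σ ∈ Γ) :
    ∑ i : Fin N, ‖PN Γ σ (EuclideanSpace.single i 1)‖ ^ 2 = (N : ℝ) - k := by
  obtain ⟨U, f, hU, hσU, hf, hs, hΓU⟩ := hΓ.2.2 σ hσ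
  have hker : tang Γ σ = (fderiv ℝ f σ).ker := by
    ext v
    rw [tang_eq hf hU hσU hσ hΓU (hs σ hσU)]; rfl
  have h1 : ∀ v, ‖PN Γ σ v‖ ^ 2 = ⟪v, PN Γ σ v⟫ := by
    intro v
    unfold PN
    rw [← real_inner_self_eq_norm_sq, Submodule.inner_starProjection_left_eq_right]
    congr 1
    exact Submodule.starProjection_eq_self_iff.2 (Submodule.starProjection_apply_mem _ _)
  have h2 := LinearMap.trace_eq_sum_inner (PN Γ σ : Euc N →ₗ[ℝ] Euc N)
    (EuclideanSpace.basisFun (Fin N) ℝ)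
  have h3 : LinearMap.IsProj (tang Γ σ)ᗮ (PN Γ σ : Euc N →ₗ[ℝ] Euc N) :=
    ⟨fun v => Submodule.starProjection_apply_mem _ _,
      fun v hv => Submodule.starProjection_eq_self_iff.2 hv⟩
  rw [h3.trace] at h2
  simp only [h1]
  simp only [EuclideanSpace.basisFun_apply] at h2
  have h4 := Submodule.finrank_add_finrank_orthogonal (tang Γ σ)
  have h5 := LinearMap.finrank_range_add_finrank_ker (fderiv ℝ f σ : Euc N →ₗ[ℝ] Euc (N - k))
  rw [LinearMap.range_eq_top.2 (hs σ hσU), finrank_top] at h5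
  rw [hker] at h4 h2
  simp only [finrank_euclideanSpace, Fintype.card_fin] at h4 h5
  have h7 : Module.finrank ℝ ((fderiv ℝ f σ).ker) + (N - k) = N := by
    rw [add_comm]; exact h5
  rw [Nat.add_left_cancel (h4.trans h7.symm)] at h2
  rw [← Nat.cast_sub hk, h2]; rfl

/-- Adjoint as a real-linear continuous map. -/
def adjL (N m : ℕ) : (Euc N →L[ℝ] Euc m) →L[ℝ] (Euc m →L[ℝ] Euc N) :=
  LinearMap.toContinuousLinearMap
    { toFun := fun A => ContinuousLinearMap.adjoint A
      map_add' := fun A B => map_add _ A B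
      map_smul' := fun c A => by simp }

theorem adjL_apply {N m : ℕ} (A : Euc N →L[ℝ] Euc m) :
    adjL N m A = ContinuousLinearMap.adjoint A := rfl

theorem gram_invertible {N m : ℕ} (A : Euc N →L[ℝ] Euc m) (hA : Function.Surjective A) :
    ∃ e : Euc m ≃L[ℝ] Euc m, (e : Euc m →L[ℝ] Euc m) = A ∘L (adjL N m A) := by
  have hinj : Function.Injective (A ∘L (adjL N m A) : Euc m →L[ℝ] Euc m) := by
    rw [injective_iff_map_eq_zero]
    intro y hy
    have h1 : ⟪(adjL N m A) y, (adjL N m A) y⟫ = 0 := by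
      rw [adjL_apply]
      rw [ContinuousLinearMap.adjoint_inner_right]
      have : A ((ContinuousLinearMap.adjoint A) y) = 0 := hy
      rw [this, inner_zero_left]
    rw [inner_self_eq_zero] at h1
    obtain ⟨z, rfl⟩ := hA y
    have h2 : ⟪(adjL N m A) (A z), z⟫ = 0 := by rw [h1, inner_zero_left]
    rw [adjL_apply, ContinuousLinearMap.adjoint_inner_left, inner_self_eq_zero] at h2
    exact h2
  let e' := LinearEquiv.ofInjectiveEndo (A ∘L (adjL N m A) : Euc m →L[ℝ] Euc m).toLinearMap hinj
  refine ⟨e'.toContinuousLinearEquiv, ?_⟩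
  ext1 v
  rfl

/-- Pseudo-inverse for surjective maps. -/
def pinv {N m : ℕ} (A : Euc N →L[ℝ] Euc m) : Euc m →L[ℝ] Euc N :=
  (adjL N m A) ∘L (ContinuousLinearMap.inverse (A ∘L (adjL N m A)))

theorem pinv_contDiffAt {N m : ℕ} (A : Euc N →L[ℝ] Euc m) (hA : Function.Surjective A) :
    ContDiffAt ℝ (⊤ : ℕ∞) (pinv (N := N) (m := m)) A := by
  obtain ⟨e, he⟩ := gram_invertible A hA
  have h1 : ContDiff ℝ (⊤ : ℕ∞) (fun A : Euc N →L[ℝ] Euc m => A ∘L (adjL N m A)) :=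
    contDiff_id.clm_comp (adjL N m).contDiff
  have h2 : ContDiffAt ℝ (⊤ : ℕ∞)
      (fun B : Euc m →L[ℝ] Euc m => ContinuousLinearMap.inverse B) (A ∘L (adjL N m A)) := by
    rw [← he]
    exact contDiffAt_map_inverse e
  have h3 := ContDiffAt.comp A h2 h1.contDiffAt
  exact (adjL N m).contDiff.contDiffAt.clm_comp h3

theorem pinv_comp {N m : ℕ} (A : Euc N →L[ℝ] Euc m) (hA : Function.Surjective A)
    (T : Submodule ℝ (Euc N)) (hT : ∀ v, v ∈ T ↔ A v = 0) :
    (pinv A) ∘L A = Tᗮ.starProjection := by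
  obtain ⟨e, he⟩ := gram_invertible A hA
  ext1 v
  symm
  have hmem : (pinv A ∘L A) v ∈ Tᗮ := by
    rw [Submodule.mem_orthogonal]
    intro w hw
    rw [hT] at hw
    simp only [pinv, ContinuousLinearMap.comp_apply]
    rw [adjL_apply, ContinuousLinearMap.adjoint_inner_right, hw, inner_zero_left]
  apply Submodule.eq_starProjection_of_mem_orthogonal hmem
  rw [Submodule.orthogonal_orthogonal, hT, map_sub, sub_eq_zero]
  simp only [pinv, ContinuousLinearMap.comp_apply]
  have h1 : ∀ y, A ((adjL N m A) y) = e y := by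
    intro y
    have := congrArg (fun L => L y) he
    simpa using this.symm
  rw [h1, ← he, ContinuousLinearMap.inverse_equiv]
  simp

theorem loc_field {N k : ℕ} {Γ : Set (Euc N)} (hΓ : IsSmoothSubmanifold N k Γ) {x : Euc N}
    (hx : x ∈ Γ) : ∃ (W : Set (Euc N)) (V : Euc N → Euc N), IsOpen W ∧ x ∈ W ∧
      ContDiffOn ℝ (⊤ : ℕ∞) V W ∧ ∀ σ ∈ Γ, σ ∈ W → V σ = 0 ∧ HasFDerivAt V (PN Γ σ) σ := by
  obtain ⟨U, f, hU, hxU, hf, hs, hΓU⟩ := hΓ.2.2 x hx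
  have hfd : ContDiff ℝ (⊤ : ℕ∞) (fderiv ℝ f) := hf.fderiv_right (by simp)
  have hB : ∀ y ∈ U, ContDiffAt ℝ (⊤ : ℕ∞) (fun z => pinv (fderiv ℝ f z)) y := fun y hy =>
    ContDiffAt.comp y (pinv_contDiffAt _ (hs y hy)) hfd.contDiffAt
  refine ⟨U, fun y => pinv (fderiv ℝ f y) (f y), hU, hxU, ?_, ?_⟩
  · intro y hy
    exact ((hB y hy).clm_apply hf.contDiffAt).contDiffWithinAt
  · intro σ hσ hσU
    have hfσ : f σ = 0 := by
      have : σ ∈ Γ ∩ U := ⟨hσ, hσU⟩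
      rw [hΓU] at this
      exact this.2
    refine ⟨by simp [hfσ], ?_⟩
    have h1 := ((hB σ hσU).differentiableAt (by simp)).hasFDerivAt.clm_apply
      (hf.differentiable (by simp) σ).hasFDerivAt
    have h2 := pinv_comp (fderiv ℝ f σ) (hs σ hσU) (tang Γ σ)
      (tang_eq hf hU hσU hσ hΓU (hs σ hσU))
    rw [hfσ, h2] at h1
    simpa [PN] using h1

theorem glob_field {N k : ℕ} {Γ : Set (Euc N)} (hΓ : IsSmoothSubmanifold N k Γ) :
    ∃ V : Euc N → Euc N, ContDiff ℝ (⊤ : ℕ∞) V ∧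
      ∀ σ ∈ Γ, V σ = 0 ∧ HasFDerivAt V (PN Γ σ) σ := by
  choose W V hWo hxW hVW hV using fun x : Γ => loc_field hΓ x.2
  obtain ⟨ρ, hρ⟩ := SmoothPartitionOfUnity.exists_isSubordinate
    (modelWithCornersSelf ℝ (Euc N)) hΓ.1.isClosed W hWo
    (fun x hx => Set.mem_iUnion.2 ⟨⟨x, hx⟩, hxW _⟩)
  have hsm := hρ.contMDiff_finsum_smul (n := ⊤) (g := V) hWo
    (fun i => (hVW i).contMDiffOn)
  rw [contMDiff_iff_contDiff] at hsm
  refine ⟨fun x => ∑ᶠ i, ρ i x • V i x, hsm, ?_⟩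
  intro σ hσ
  have hV0 : ∀ i ∈ ρ.fintsupport σ, V i σ = 0 ∧ HasFDerivAt (V i) (PN Γ σ) σ := by
    intro i hi
    rw [ρ.mem_fintsupport_iff] at hi
    exact hV i σ hσ (hρ i hi)
  have hev : ∀ᶠ y in 𝓝 σ, ∑ᶠ i, ρ i y • V i y = ∑ i ∈ ρ.fintsupport σ, ρ i y • V i y := by
    filter_upwards [ρ.eventually_finsupport_subset σ] with y hy
    apply finsum_eq_sum_of_support_subset
    intro i hi
    apply hy
    rw [ρ.mem_finsupport]
    intro h0
    apply hi
    simp [h0]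
  have hsum : ∑ i ∈ ρ.fintsupport σ, ρ i σ = 1 := by
    rw [← ρ.sum_eq_one hσ]
    symm
    apply finsum_eq_sum_of_support_subset
    intro i hi
    apply ρ.finsupport_subset_fintsupport σ
    rw [ρ.mem_finsupport]; exact hi
  constructor
  · refine hev.self_of_nhds.trans ?_
    exact Finset.sum_eq_zero fun i hi => by rw [(hV0 i hi).1, smul_zero]
  · have hd : HasFDerivAt (fun y => ∑ i ∈ ρ.fintsupport σ, ρ i y • V i y)
        (∑ i ∈ ρ.fintsupport σ, ρ i σ • PN Γ σ) σ := by
      apply HasFDerivAt.fun_sum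
      intro i hi
      have hρi : ContDiff ℝ (⊤ : ℕ∞) (ρ i) := (ρ i).contMDiff.contDiff
      have := (hρi.differentiable (by simp) σ).hasFDerivAt.smul (hV0 i hi).2
      rw [(hV0 i hi).1] at this
      convert! this using 1
      ext v : 1
      simp
    rw [← Finset.sum_smul, hsum, one_smul] at hd
    exact hd.congr_of_eventuallyEq hev

theorem lap_eq_of {N : ℕ} {φ : Euc N → ℝ} {x : Euc N} (hφ : ContDiffAt ℝ 2 φ x)
    (b : Fin N → ℝ)
    (h : ∀ i, HasFDerivAt (fun y => fderiv ℝ φ y (EuclideanSpace.single i 1))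
      (fderiv ℝ (fun y => fderiv ℝ φ y (EuclideanSpace.single i 1)) x) x →
      fderiv ℝ (fun y => fderiv ℝ φ y (EuclideanSpace.single i 1)) x (EuclideanSpace.single i 1)
        = b i) :
    lap φ x = ∑ i, b i := by
  unfold lap
  apply Finset.sum_congr rfl
  intro i _
  have h1 : DifferentiableAt ℝ (fderiv ℝ φ) x :=
    (hφ.fderiv_right (m := 1) (by norm_num)).differentiableAt (by simp)
  have h2 := h1.hasFDerivAt.clm_apply
    (hasFDerivAt_const (EuclideanSpace.single i (1 : ℝ) : Euc N) x)
  rw [iteratedFDeriv_two_apply, ← h i h2.differentiableAt.hasFDerivAt, h2.fderiv]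
  simp

theorem bound_fdd {E : Type*} [NormedAddCommGroup E] [NormedSpace ℝ E]
    {V : E → E} (hV : ContDiff ℝ (⊤ : ℕ∞) V) {K : Set E} (hK : IsCompact K) :
    ∃ M, 0 ≤ M ∧ ∀ y ∈ K, ‖fderiv ℝ (fderiv ℝ V) y‖ ≤ M := by
  have hV1 : ContDiff ℝ (⊤ : ℕ∞) (fderiv ℝ V) := hV.fderiv_right (by simp)
  have hV2 : ContDiff ℝ (⊤ : ℕ∞) (fderiv ℝ (fderiv ℝ V)) := hV1.fderiv_right (by simp)
  obtain ⟨M, hM⟩ := hK.exists_bound_of_continuousOn hV2.continuous.continuousOn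
  exact ⟨max M 0, le_max_right _ _, fun y hy => (hM y hy).trans (le_max_left _ _)⟩

set_option maxHeartbeats 1000000 in
theorem D_est {N k : ℕ} (hk : k ≤ N) {Γ : Set (Euc N)} (hΓ : IsSmoothSubmanifold N k Γ) :
    ∃ D : Euc N → ℝ, ContDiff ℝ (⊤ : ℕ∞) D ∧ ∃ C > 0, ∀ x, infDist x Γ ≤ 1 →
      |D x - infDist x Γ ^ 2| ≤ C * infDist x Γ ^ 3 ∧
      |∑ i, (fderiv ℝ D x (EuclideanSpace.single i 1)) ^ 2 - 4 * infDist x Γ ^ 2|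
        ≤ C * infDist x Γ ^ 3 ∧
      |lap D x - 2 * ((N : ℝ) - k)| ≤ C * infDist x Γ := by
  obtain ⟨V, hVs, hV⟩ := glob_field hΓ
  have hKc : IsCompact (cthickening 1 Γ) := hΓ.1.cthickening
  have hV1 : ContDiff ℝ (⊤ : ℕ∞) (fderiv ℝ V) := hVs.fderiv_right (by simp)
  have hV2 : ContDiff ℝ (⊤ : ℕ∞) (fderiv ℝ (fderiv ℝ V)) := hV1.fderiv_right (by simp)
  obtain ⟨M, hM0, hM⟩ := bound_fdd hVs hKc
  have hVd : ∀ x, HasFDerivAt V (fderiv ℝ V x) x := fun x =>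
    (hVs.differentiable (by simp) x).hasFDerivAt
  have hVdd : ∀ x, HasFDerivAt (fderiv ℝ V) (fderiv ℝ (fderiv ℝ V) x) x := fun x =>
    (hV1.differentiable (by simp) x).hasFDerivAt
  have hDs : ContDiff ℝ (⊤ : ℕ∞) (fun x => ⟪V x, V x⟫) := hVs.inner ℝ hVs
  have hDd : ∀ x e, fderiv ℝ (fun x => ⟪V x, V x⟫) x e = 2 * ⟪V x, fderiv ℝ V x e⟫ := by
    intro x e
    rw [((hVd x).inner ℝ (hVd x)).fderiv]
    simp only [ContinuousLinearMap.comp_apply, ContinuousLinearMap.prod_apply,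
      fderivInnerCLM_apply]
    rw [real_inner_comm (V x)]; ring
  have hlap : ∀ x, lap (fun x => ⟪V x, V x⟫) x =
      ∑ i, (2 * (‖fderiv ℝ V x (EuclideanSpace.single i 1)‖ ^ 2 +
        ⟪V x, fderiv ℝ (fderiv ℝ V) x (EuclideanSpace.single i 1) (EuclideanSpace.single i 1)⟫)) := by
    intro x
    apply lap_eq_of ((contDiff_infty.1 hDs 2).contDiffAt)
    intro i _
    simp only [hDd]
    have h2 := (hVdd x).clm_apply
      (hasFDerivAt_const (EuclideanSpace.single i (1 : ℝ) : Euc N) x)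
    have h3 := ((hVd x).inner ℝ h2).const_mul 2
    rw [h3.fderiv]
    simp only [ContinuousLinearMap.comp_apply, ContinuousLinearMap.prod_apply,
      fderivInnerCLM_apply, smul_apply]
    simp
    ring
  set C1 := M ^ 2 + 2 * M with hC1
  have hC10 : 0 ≤ C1 := by positivity
  refine ⟨fun x => ⟪V x, V x⟫, hDs,
    C1 + N * (4 * (C1 * (2 + C1))) + N * (2 * (C1 + (1 + M) * M)) + 1, by positivity, ?_⟩
  intro x hx1
  obtain ⟨σ, hσ, hxσ⟩ := hΓ.1.exists_infDist_eq_dist hΓ.2.1 x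
  set d := infDist x Γ with hd
  have hd0 : 0 ≤ d := infDist_nonneg
  set n := x - σ with hn
  have hnd : ‖n‖ = d := by rw [hn, hxσ, dist_eq_norm]
  have hsub : closedBall σ d ⊆ cthickening 1 Γ :=
    (closedBall_subset_closedBall hx1).trans (closedBall_subset_cthickening hσ 1)
  have hxb : x ∈ closedBall σ d := by rw [mem_closedBall, hxσ]
  have hσb : σ ∈ closedBall σ d := mem_closedBall_self hd0
  obtain ⟨hVσ, hPσ⟩ := hV σ hσ
  have hP := PN_nearest hΓ hσ hxσ
  rw [← hn] at hP
  have hs : ∀ y ∈ closedBall σ d, ‖fderiv ℝ V y - PN Γ σ‖ ≤ M * d := by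
    intro y hy
    have := (convex_closedBall σ d).norm_image_sub_le_of_norm_fderiv_le (𝕜 := ℝ) (f := fderiv ℝ V)
      (fun z _ => hV1.differentiable (by simp) z) (fun z hz => hM z (hsub hz)) hσb hy
    rw [hPσ.fderiv] at this
    rw [mem_closedBall, dist_eq_norm] at hy
    exact this.trans (by gcongr)
  have hr : ‖V x - n‖ ≤ M * d ^ 2 := by
    have := (convex_closedBall σ d).norm_image_sub_le_of_norm_fderiv_le' (𝕜 := ℝ) (f := V)
      (φ := PN Γ σ)
      (fun z _ => hVs.differentiable (by simp) z) hs hσb hxb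
    rw [hVσ, sub_zero, ← hn, hP, hnd] at this
    linarith
  have hVn : ‖V x‖ ≤ (1 + M) * d := by
    have h1 : ‖V x‖ ≤ ‖n‖ + ‖V x - n‖ := by
      have := norm_add_le n (V x - n)
      simpa using this
    have h2 : M * d ^ 2 ≤ M * d := by
      apply mul_le_mul_of_nonneg_left _ hM0
      nlinarith
    linarith
  have hPle : ∀ v, ‖PN Γ σ v‖ ≤ ‖v‖ := fun v => Submodule.norm_starProjection_apply_le _ v
  have he : ∀ i : Fin N, ‖(EuclideanSpace.single i 1 : Euc N)‖ = 1 := fun i => by simp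
  have hsx := hs x hxb
  -- pieces
  have hd2 : d ^ 2 ≤ d := by nlinarith
  have hd3 : d ^ 4 ≤ d ^ 3 := by
    have : 0 ≤ d ^ 3 := by positivity
    nlinarith
  have hw : ∀ i : Fin N, ‖fderiv ℝ V x (EuclideanSpace.single i 1) -
      PN Γ σ (EuclideanSpace.single i 1)‖ ≤ M * d := by
    intro i
    have := (fderiv ℝ V x - PN Γ σ).le_opNorm (EuclideanSpace.single i 1 : Euc N)
    rw [he, mul_one] at this
    exact this.trans hsx
  have hC1a : M * d ^ 2 * (2 * d + M * d ^ 2) ≤ C1 * d ^ 3 := by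
    rw [hC1]; nlinarith [mul_nonneg hM0 hM0]
  refine ⟨?_, ?_, ?_⟩
  · have h1 : ⟪V x, V x⟫ - d ^ 2 = ⟪V x - n, V x - n⟫ + 2 * ⟪n, V x - n⟫ := by
      rw [← hnd, ← real_inner_self_eq_norm_sq]
      simp only [inner_sub_left, inner_sub_right]
      rw [real_inner_comm n (V x)]; ring
    have h2 := abs_real_inner_le_norm (V x - n) (V x - n)
    have h3 := abs_real_inner_le_norm n (V x - n)
    rw [hnd] at h3
    have h4 : ‖V x - n‖ * ‖V x - n‖ ≤ (M * d ^ 2) * (M * d ^ 2) := by gcongr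
    have h5 : d * ‖V x - n‖ ≤ d * (M * d ^ 2) := by gcongr
    have h6 : |⟪V x, V x⟫ - d ^ 2| ≤ C1 * d ^ 3 := by
      rw [h1]
      rw [abs_le] at h2 h3 ⊢
      constructor <;> linarith
    refine h6.trans ?_
    gcongr
    have : 0 ≤ N * (4 * (C1 * (2 + C1))) + N * (2 * (C1 + (1 + M) * M)) + 1 := by positivity
    linarith
  · have hsumn : d ^ 2 = ∑ i : Fin N, ⟪n, EuclideanSpace.single i 1⟫ ^ 2 := by
      rw [← hnd, EuclideanSpace.real_norm_sq_eq]
      refine Finset.sum_congr rfl fun i _ => ?_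
      rw [EuclideanSpace.inner_single_right]
      simp
    have hterm : ∀ i : Fin N,
        |(2 * ⟪V x, fderiv ℝ V x (EuclideanSpace.single i 1)⟫) ^ 2
          - 4 * ⟪n, EuclideanSpace.single i 1⟫ ^ 2| ≤ 4 * (C1 * (2 + C1)) * d ^ 3 := by
      intro i
      set e : Euc N := EuclideanSpace.single i 1 with hee
      set s := fderiv ℝ V x e - PN Γ σ e with hs'
      have hsi : ‖s‖ ≤ M * d := hw i
      have e1 : ⟪V x, fderiv ℝ V x e⟫ - ⟪n, e⟫ = ⟪V x, s⟫ + ⟪V x - n, PN Γ σ e⟫ := by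
        have : ⟪n, PN Γ σ e⟫ = ⟪n, e⟫ := by
          conv_rhs => rw [← hP]
          exact (Submodule.inner_starProjection_left_eq_right _ n e).symm
        rw [hs']
        simp only [inner_sub_left, inner_sub_right]
        rw [this]; ring
      have h2 := abs_real_inner_le_norm (V x) s
      have h3 := abs_real_inner_le_norm (V x - n) (PN Γ σ e)
      have h4 : ‖V x‖ * ‖s‖ ≤ ((1 + M) * d) * (M * d) := by gcongr
      have h5 : ‖V x - n‖ * ‖PN Γ σ e‖ ≤ (M * d ^ 2) * 1 := by
        gcongr
        exact (hPle e).trans (he i).le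
      have h6 : |⟪V x, fderiv ℝ V x e⟫ - ⟪n, e⟫| ≤ C1 * d ^ 2 := by
        rw [e1]
        rw [abs_le] at h2 h3 ⊢
        have h10 : ((1 + M) * d) * (M * d) + (M * d ^ 2) * 1 = C1 * d ^ 2 := by rw [hC1]; ring
        constructor <;> linarith
      have h7 : |⟪n, e⟫| ≤ d := by
        have := abs_real_inner_le_norm n e
        rwa [hnd, he i, mul_one] at this
      have h8 : (2 * ⟪V x, fderiv ℝ V x e⟫) ^ 2 - 4 * ⟪n, e⟫ ^ 2 =
        4 * ((⟪V x, fderiv ℝ V x e⟫ - ⟪n, e⟫) *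
          ((⟪V x, fderiv ℝ V x e⟫ - ⟪n, e⟫) + 2 * ⟪n, e⟫)) := by ring
      rw [h8, abs_mul, abs_mul]
      have h9 : |(⟪V x, fderiv ℝ V x e⟫ - ⟪n, e⟫) + 2 * ⟪n, e⟫| ≤ (C1 + 2) * d := by
        refine (abs_add_le _ _).trans ?_
        rw [abs_mul, abs_two]
        have : C1 * d ^ 2 ≤ C1 * d := mul_le_mul_of_nonneg_left hd2 hC10
        linarith
      calc |(4 : ℝ)| * (|⟪V x, fderiv ℝ V x e⟫ - ⟪n, e⟫| *
            |(⟪V x, fderiv ℝ V x e⟫ - ⟪n, e⟫) + 2 * ⟪n, e⟫|)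
          ≤ 4 * ((C1 * d ^ 2) * ((C1 + 2) * d)) := by
            rw [abs_of_pos (by norm_num : (0 : ℝ) < 4)]
            gcongr
        _ = 4 * (C1 * (2 + C1)) * d ^ 3 := by ring
    simp only [hDd]
    rw [hsumn, Finset.mul_sum, ← Finset.sum_sub_distrib]
    refine (Finset.abs_sum_le_sum_abs _ _).trans ?_
    refine (Finset.sum_le_sum fun i _ => hterm i).trans ?_
    rw [Finset.sum_const, Finset.card_univ, Fintype.card_fin, nsmul_eq_mul, ← mul_assoc]
    gcongr
    have : 0 ≤ N * (2 * (C1 + (1 + M) * M)) + 1 := by positivity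
    linarith
  · have htr := PN_trace hk hΓ hσ
    rw [hlap, ← htr, Finset.mul_sum, ← Finset.sum_sub_distrib]
    refine (Finset.abs_sum_le_sum_abs _ _).trans ?_
    have hterm : ∀ i : Fin N,
        |2 * (‖fderiv ℝ V x (EuclideanSpace.single i 1)‖ ^ 2 +
        ⟪V x, fderiv ℝ (fderiv ℝ V) x (EuclideanSpace.single i 1) (EuclideanSpace.single i 1)⟫)
         - 2 * ‖PN Γ σ (EuclideanSpace.single i 1)‖ ^ 2| ≤ 2 * (C1 + (1 + M) * M) * d := by
      intro i
      set e : Euc N := EuclideanSpace.single i 1 with hee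
      have h1 : |‖fderiv ℝ V x e‖ - ‖PN Γ σ e‖| ≤ M * d := (abs_norm_sub_norm_le _ _).trans (hw i)
      have h2 : ‖PN Γ σ e‖ ≤ 1 := (hPle e).trans (he i).le
      have h3 : ‖fderiv ℝ (fderiv ℝ V) x e e‖ ≤ M := by
        refine (ContinuousLinearMap.le_opNorm₂ _ e e).trans ?_
        rw [he i, mul_one, mul_one]
        exact hM x (hsub hxb)
      have h4 := (abs_real_inner_le_norm (V x) (fderiv ℝ (fderiv ℝ V) x e e)).trans
        (mul_le_mul hVn h3 (norm_nonneg _) (by positivity))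
      have h5 : |‖fderiv ℝ V x e‖ ^ 2 - ‖PN Γ σ e‖ ^ 2| ≤ C1 * d := by
        have : ‖fderiv ℝ V x e‖ ^ 2 - ‖PN Γ σ e‖ ^ 2 = (‖fderiv ℝ V x e‖ - ‖PN Γ σ e‖) *
          ((‖fderiv ℝ V x e‖ - ‖PN Γ σ e‖) + 2 * ‖PN Γ σ e‖) := by ring
        rw [this, abs_mul]
        have h6 : |(‖fderiv ℝ V x e‖ - ‖PN Γ σ e‖) + 2 * ‖PN Γ σ e‖| ≤ M + 2 := by
          refine (abs_add_le _ _).trans ?_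
          rw [abs_mul, abs_two, abs_norm]
          have : M * d ≤ M * 1 := by gcongr
          linarith
        calc _ ≤ (M * d) * (M + 2) := by gcongr
          _ = C1 * d := by rw [hC1]; ring
      rw [abs_le] at h4 h5 ⊢
      constructor <;> linarith
    refine (Finset.sum_le_sum fun i _ => hterm i).trans ?_
    rw [Finset.sum_const, Finset.card_univ, Fintype.card_fin, nsmul_eq_mul, ← mul_assoc]
    gcongr
    have : 0 ≤ C1 + N * (4 * (C1 * (2 + C1))) + 1 := by positivity
    linarith

theorem lap_comp {N : ℕ} {D : Euc N → ℝ} (hD : ContDiff ℝ (⊤ : ℕ∞) D) {x : Euc N} (hx : 0 < D x)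
    {F F1 F2 : ℝ → ℝ} (hF : ∀ t > 0, HasDerivAt F (F1 t) t)
    (hF1 : ∀ t > 0, HasDerivAt F1 (F2 t) t) (hc : ContDiffAt ℝ 2 (fun y => F (D y)) x) :
    lap (fun y => F (D y)) x =
      F2 (D x) * ∑ i, (fderiv ℝ D x (EuclideanSpace.single i 1)) ^ 2 + F1 (D x) * lap D x := by
  have hDd : ∀ x, HasFDerivAt D (fderiv ℝ D x) x := fun x =>
    (hD.differentiable (by simp) x).hasFDerivAt
  have hD1 : ContDiff ℝ (⊤ : ℕ∞) (fderiv ℝ D) := hD.fderiv_right (by simp)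
  have hDdd := (hD1.differentiable (by simp) x).hasFDerivAt
  rw [lap_eq_of (contDiff_infty.1 hD 2).contDiffAt _ (fun i _ => rfl)]
  rw [Finset.mul_sum, Finset.mul_sum, ← Finset.sum_add_distrib]
  apply lap_eq_of hc
  intro i _
  have hev : (fun y => fderiv ℝ (fun y => F (D y)) y (EuclideanSpace.single i 1)) =ᶠ[𝓝 x]
      fun y => F1 (D y) * fderiv ℝ D y (EuclideanSpace.single i 1) := by
    have : ∀ᶠ y in 𝓝 x, 0 < D y := hD.continuous.continuousAt.eventually (lt_mem_nhds hx)
    filter_upwards [this] with y hy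
    have h1 : HasFDerivAt (fun y => F (D y)) _ y := (hF (D y) hy).comp_hasFDerivAt y (hDd y)
    rw [h1.fderiv]; simp
  rw [hev.fderiv_eq]
  have h2 := hDdd.clm_apply
      (hasFDerivAt_const (EuclideanSpace.single i (1 : ℝ) : Euc N) x)
  have h3 : HasFDerivAt (fun y => F1 (D y)) _ x := (hF1 (D x) hx).comp_hasFDerivAt x (hDd x)
  have h4 : HasFDerivAt (fun y => F1 (D y) * fderiv ℝ D y (EuclideanSpace.single i 1)) _ x :=
    h3.mul h2.differentiableAt.hasFDerivAt
  rw [h4.fderiv]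
  simp
  ring

theorem alg_ineq {a ε C X Y s γ L w q m b1 b2 : ℝ} (hC : 0 ≤ C) (hs0 : 0 ≤ s) (hs1 : s ≤ 1)
    (hY : 0 ≤ Y) (hYX : Y ≤ X) (hb2 : 0 ≤ b2) (hb : b2 ≤ b1) (hb1 : b1 = a / 2)
    (hb2' : b2 = (a - ε) / 2) (hm : m = 2 * a + 2)
    (hγ : |γ - 4| ≤ 40 * C * s) (hL : |L - 2 * m| ≤ 2 * C * s)
    (hw0 : 0 ≤ w) (hw : w ≤ 1 + 2 * C * s) (hq0 : 0 ≤ q) (hq : q ≤ 1 + 2 * C * s) :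
    ε ^ 2 * Y - (40 * C * (b1 * (b1 + 1)) + 2 * C * b1 + a ^ 2 * (4 * C + 4 * C ^ 2)) * (s * X) ≤
      -(γ * (b1 * (b1 + 1) * X - b2 * (b2 + 1) * Y) - L * (b1 * X - b2 * Y))
        - a ^ 2 * (w * q) * (X - Y) := by
  have hb10 : 0 ≤ b1 := hb2.trans hb
  have hX : 0 ≤ X := hY.trans hYX
  set P := b1 * (b1 + 1) * X - b2 * (b2 + 1) * Y with hP
  set Q := b1 * X - b2 * Y with hQ
  have hP1 : P ≤ b1 * (b1 + 1) * X := by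
    have : 0 ≤ b2 * (b2 + 1) * Y := by positivity
    linarith
  have hP0 : 0 ≤ P := by
    have : b2 * (b2 + 1) * Y ≤ b1 * (b1 + 1) * X := by gcongr
    linarith
  have hQ1 : Q ≤ b1 * X := by
    have : 0 ≤ b2 * Y := by positivity
    linarith
  have hQ0 : 0 ≤ Q := by
    have : b2 * Y ≤ b1 * X := by gcongr
    linarith
  have e1 : γ * P ≤ 4 * P + 40 * C * s * (b1 * (b1 + 1) * X) := by
    have h1 : (γ - 4) * P ≤ (40 * C * s) * P :=
      mul_le_mul_of_nonneg_right (le_of_abs_le hγ) hP0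
    have h2 : (40 * C * s) * P ≤ (40 * C * s) * (b1 * (b1 + 1) * X) := by gcongr
    linarith
  have e2 : 2 * m * Q - 2 * C * s * (b1 * X) ≤ L * Q := by
    have h1 : -(2 * C * s) * Q ≤ (L - 2 * m) * Q :=
      mul_le_mul_of_nonneg_right (neg_le_of_abs_le hL) hQ0
    have h2 : (2 * C * s) * Q ≤ (2 * C * s) * (b1 * X) := by gcongr
    linarith
  have e3 : a ^ 2 * (w * q) * (X - Y) ≤ a ^ 2 * (X - Y) + a ^ 2 * (4 * C + 4 * C ^ 2) * (s * X) := by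
    have h1 : w * q ≤ (1 + 2 * C * s) * (1 + 2 * C * s) := by gcongr
    have h2 : (1 + 2 * C * s) * (1 + 2 * C * s) ≤ 1 + (4 * C + 4 * C ^ 2) * s := by
      have : C ^ 2 * (s * s) ≤ C ^ 2 * (s * 1) := by gcongr
      nlinarith
    have h3 : 0 ≤ X - Y := by linarith
    calc a ^ 2 * (w * q) * (X - Y) ≤ a ^ 2 * (1 + (4 * C + 4 * C ^ 2) * s) * (X - Y) := by
          gcongr
          exact h1.trans h2
      _ = a ^ 2 * (X - Y) + a ^ 2 * (4 * C + 4 * C ^ 2) * (s * (X - Y)) := by ring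
      _ ≤ _ := by
          gcongr
          linarith
  have e4 : -4 * P + 2 * m * Q - a ^ 2 * (X - Y) = ε ^ 2 * Y := by
    rw [hP, hQ, hb1, hb2', hm]; ring
  linarith

set_option maxHeartbeats 1000000 in
theorem real_ineq {a ε C p m : ℝ} (ha : 0 < a) (hε : 0 < ε) (hεa : ε < a) (hε1 : ε < 1)
    (hC : 0 < C) (hp : 1 ≤ p) (hap : a * p < a + 2 - ε) (hm : m = 2 * a + 2) :
    ∃ β > 0, β ≤ 1 ∧ ∀ d t G L q : ℝ, 0 < d → d < β → |t - d ^ 2| ≤ C * d ^ 3 →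
      |G - 4 * d ^ 2| ≤ C * d ^ 3 → |L - 2 * m| ≤ C * d → 0 ≤ q → q ≤ 1 + C * d →
      d ^ 2 / 2 ≤ t ∧ t < 1 ∧ 0 < t ^ (-(a / 2)) - t ^ (-((a - ε) / 2)) ∧
      (t ^ (-(a / 2)) - t ^ (-((a - ε) / 2))) ^ p ≤
        -((((a / 2) * (a / 2 + 1)) * t ^ (-(a / 2) - 2)
            - (((a - ε) / 2) * ((a - ε) / 2 + 1)) * t ^ (-((a - ε) / 2) - 2)) * G
          + (-(a / 2) * t ^ (-(a / 2) - 1) + ((a - ε) / 2) * t ^ (-((a - ε) / 2) - 1)) * L)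
        - a ^ 2 * d ^ (-2 : ℝ) * q * (t ^ (-(a / 2)) - t ^ (-((a - ε) / 2))) := by
  set b1 := a / 2 with hb1
  set b2 := (a - ε) / 2 with hb2
  set K := 40 * C * (b1 * (b1 + 1)) + 2 * C * b1 + a ^ 2 * (4 * C + 4 * C ^ 2) with hK
  have hb10 : 0 < b1 := by positivity
  have hb20 : 0 < b2 := by rw [hb2]; linarith
  have hbb : b2 < b1 := by rw [hb1, hb2]; linarith
  have hK0 : 0 < K := by positivity
  have hsm : ∀ θ : ℝ, 0 < θ → ∀ η : ℝ, 0 < η → ∀ᶠ t in 𝓝[>] (0 : ℝ), t ^ θ < η := by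
    intro θ hθ η hη
    have h1 : Tendsto (fun t : ℝ => t ^ θ) (𝓝 0) (𝓝 0) := by
      have := (Real.continuousAt_rpow_const 0 θ (Or.inr hθ.le)).tendsto
      rwa [Real.zero_rpow hθ.ne'] at this
    exact (h1.eventually (gt_mem_nhds hη)).filter_mono nhdsWithin_le_nhds
  have hA := hsm ((1 - ε) / 2) (by linarith) (ε ^ 2 / 2 / K) (by positivity)
  have hB := hsm (b1 + 1 - ε / 2 - b1 * p) (by rw [hb1]; linarith) (ε ^ 2 / 2) (by positivity)
  obtain ⟨t0, ht0, ht0'⟩ := mem_nhdsGT_iff_exists_Ioo_subset.1 (hA.and hB)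
  have ht00 : 0 < t0 := ht0
  refine ⟨min (1 / 2) (min (1 / (2 * C)) (t0 / 2)), by positivity,
    (min_le_left _ _).trans (by norm_num), ?_⟩
  intro d t G L q hd hdβ ht hG hL hq0 hq
  have hd1 : d < 1 / 2 := hdβ.trans_le (min_le_left _ _)
  have hd2 : d < 1 / (2 * C) := hdβ.trans_le ((min_le_right _ _).trans (min_le_left _ _))
  have hd3 : d < t0 / 2 := hdβ.trans_le ((min_le_right _ _).trans (min_le_right _ _))
  have hCd : C * d < 1 / 2 := by
    rw [lt_div_iff₀ (by positivity)] at hd2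
    linarith
  have hCd3 : C * d ^ 3 ≤ d ^ 2 / 2 := by
    have : (C * d) * d ^ 2 ≤ (1 / 2) * d ^ 2 := by gcongr
    linarith
  have ht1 : d ^ 2 / 2 ≤ t := by linarith [neg_le_of_abs_le ht]
  have ht2 : t ≤ 3 / 2 * d ^ 2 := by linarith [le_of_abs_le ht]
  have htpos : 0 < t := lt_of_lt_of_le (by positivity) ht1
  have hdd : d ^ 2 ≤ d / 2 := by nlinarith
  have htlt : t < 1 := by linarith
  have htt0 : t < t0 := by linarith
  obtain ⟨hA', hB'⟩ := ht0' ⟨htpos, htt0⟩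
  have hlt : t ^ (-b2) < t ^ (-b1) :=
    Real.rpow_lt_rpow_of_exponent_gt htpos htlt (by linarith)
  refine ⟨ht1, htlt, by linarith, ?_⟩
  set s := Real.sqrt t with hs
  have hss : s ^ 2 = t := Real.sq_sqrt htpos.le
  have hs0 : 0 < s := Real.sqrt_pos.2 htpos
  have hs1 : s ≤ 1 := by
    rw [hs]
    exact Real.sqrt_le_one.2 htlt.le
  have hds : d ≤ 2 * s := by
    have h1 : d ^ 2 ≤ (2 * s) ^ 2 := by
      rw [mul_pow, hss]; linarith
    exact (pow_le_pow_iff_left₀ hd.le (by positivity) two_ne_zero).1 h1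
  set X := t ^ (-b1 - 1) with hX
  set Y := t ^ (-b2 - 1) with hY
  have hXpos : 0 < X := Real.rpow_pos_of_pos htpos _
  have hYpos : 0 < Y := Real.rpow_pos_of_pos htpos _
  have hYX : Y ≤ X := Real.rpow_le_rpow_of_exponent_ge htpos htlt.le (by linarith)
  have eX0 : t ^ (-b1) = t * X := by
    rw [hX, Real.rpow_sub_one htpos.ne']; field_simp
  have eY0 : t ^ (-b2) = t * Y := by
    rw [hY, Real.rpow_sub_one htpos.ne']; field_simp
  have eX2 : t ^ (-b1 - 2) = X / t := by
    rw [hX, ← Real.rpow_sub_one htpos.ne']; ring_nf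
  have eY2 : t ^ (-b2 - 2) = Y / t := by
    rw [hY, ← Real.rpow_sub_one htpos.ne']; ring_nf
  have hγ : |G / t - 4| ≤ 40 * C * s := by
    have h1 : |G - 4 * t| ≤ 5 * C * d ^ 3 := by
      have : G - 4 * t = (G - 4 * d ^ 2) - 4 * (t - d ^ 2) := by ring
      rw [this, abs_le]
      rw [abs_le] at hG ht
      constructor <;> linarith
    have h2 : d ^ 3 ≤ 8 * (s * t) := by
      calc d ^ 3 ≤ (2 * s) ^ 3 := by gcongr
        _ = 8 * (s * s ^ 2) := by ring
        _ = _ := by rw [hss]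
    have h3 : G / t - 4 = (G - 4 * t) / t := by field_simp
    rw [h3, abs_div, abs_of_pos htpos, div_le_iff₀ htpos]
    calc |G - 4 * t| ≤ 5 * C * d ^ 3 := h1
      _ ≤ 5 * C * (8 * (s * t)) := by gcongr
      _ = _ := by ring
  have hCds : C * d ≤ 2 * C * s := by
    have := mul_le_mul_of_nonneg_left hds hC.le
    linarith
  have hw : t / d ^ 2 ≤ 1 + 2 * C * s := by
    rw [div_le_iff₀ (by positivity)]
    have h1 : t ≤ (1 + C * d) * d ^ 2 := by linarith [le_of_abs_le ht]
    exact h1.trans (by gcongr)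
  have key := alg_ineq (a := a) (ε := ε) (γ := G / t) (L := L) (w := t / d ^ 2) (q := q)
    hC.le hs0.le hs1 hYpos.le hYX hb20.le hbb.le hb1 hb2 hm hγ (hL.trans hCds) (by positivity)
    hw hq0 (by linarith)
  rw [← hK] at key
  have hdm : d ^ (-2 : ℝ) = 1 / d ^ 2 := by
    rw [Real.rpow_neg hd.le]; norm_num
  have hR : -((b1 * (b1 + 1) * t ^ (-b1 - 2) - b2 * (b2 + 1) * t ^ (-b2 - 2)) * G
          + (-b1 * X + b2 * Y) * L)
        - a ^ 2 * d ^ (-2 : ℝ) * q * (t ^ (-b1) - t ^ (-b2)) =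
        -(G / t * (b1 * (b1 + 1) * X - b2 * (b2 + 1) * Y) - L * (b1 * X - b2 * Y))
        - a ^ 2 * (t / d ^ 2 * q) * (X - Y) := by
    rw [eX0, eY0, eX2, eY2, hdm]; ring
  rw [hR]
  refine le_trans ?_ key
  have k1 : K * (s * X) ≤ ε ^ 2 / 2 * Y := by
    have h1 : s * X = t ^ ((1 - ε) / 2) * Y := by
      rw [hs, Real.sqrt_eq_rpow, hX, hY, ← Real.rpow_add htpos, ← Real.rpow_add htpos]
      congr 1; rw [hb1, hb2]; ring
    rw [h1, ← mul_assoc]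
    gcongr
    rw [lt_div_iff₀ hK0] at hA'
    linarith
  have k2 : (t ^ (-b1) - t ^ (-b2)) ^ p ≤ ε ^ 2 / 2 * Y := by
    have h1 : (t ^ (-b1) - t ^ (-b2)) ^ p ≤ (t ^ (-b1)) ^ p := by
      apply Real.rpow_le_rpow (by linarith) _ (by linarith)
      linarith [Real.rpow_pos_of_pos htpos (-b2)]
    have h2 : (t ^ (-b1)) ^ p = t ^ (b1 + 1 - ε / 2 - b1 * p) * Y := by
      rw [← Real.rpow_mul htpos.le, hY, ← Real.rpow_add htpos]
      congr 1; rw [hb1, hb2]; ring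
    rw [h2] at h1
    exact h1.trans (by gcongr)
  linarith

theorem F_deriv (b1 b2 : ℝ) : (∀ t > 0, HasDerivAt (fun t : ℝ => t ^ (-b1) - t ^ (-b2))
      (-b1 * t ^ (-b1 - 1) + b2 * t ^ (-b2 - 1)) t) ∧
    (∀ t > 0, HasDerivAt (fun t : ℝ => -b1 * t ^ (-b1 - 1) + b2 * t ^ (-b2 - 1))
      ((b1 * (b1 + 1)) * t ^ (-b1 - 2) - (b2 * (b2 + 1)) * t ^ (-b2 - 2)) t) := by
  constructor
  · intro t ht
    have h1 := Real.hasDerivAt_rpow_const (p := -b1) (Or.inl (ne_of_gt ht))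
    have h2 := Real.hasDerivAt_rpow_const (p := -b2) (Or.inl (ne_of_gt ht))
    convert! h1.sub h2 using 1
    ring
  · intro t ht
    have h1 := (Real.hasDerivAt_rpow_const (p := -b1 - 1) (Or.inl (ne_of_gt ht))).const_mul (-b1)
    have h2 := (Real.hasDerivAt_rpow_const (p := -b2 - 1) (Or.inl (ne_of_gt ht))).const_mul b2
    convert! h1.add h2 using 1
    rw [show -b1 - 1 - 1 = -b1 - 2 by ring, show -b2 - 1 - 1 = -b2 - 2 by ring]
    ring

theorem q_lip {N : ℕ} {Γ Ω : Set (Euc N)} (hΓ : IsCompact Γ) (hne : Γ.Nonempty)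
    (hΩ : IsOpen Ω) (hΓΩ : Γ ⊆ Ω)
    (q : Euc N → ℝ) (hq : ContDiffOn ℝ 2 q (closure Ω)) (hq1 : ∀ σ ∈ Γ, q σ ≤ 1) :
    ∃ C > 0, ∃ β > 0, ∀ x, infDist x Γ < β → q x ≤ 1 + C * infDist x Γ := by
  obtain ⟨β, hβ, hsub⟩ := hΓ.exists_cthickening_subset_open hΩ hΓΩ
  have hqΩ : ContDiffOn ℝ 2 q Ω := hq.mono subset_closure
  have hcont : ContinuousOn (fun x => fderiv ℝ q x) Ω :=
    hqΩ.continuousOn_fderiv_of_isOpen hΩ (by norm_num)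
  obtain ⟨M, hM⟩ := (hΓ.cthickening (r := β)).exists_bound_of_continuousOn (hcont.mono hsub)
  refine ⟨max M 1, by positivity, β, hβ, ?_⟩
  intro x hx
  obtain ⟨σ, hσ, hxσ⟩ := hΓ.exists_infDist_eq_dist hne x
  have hb : closedBall σ β ⊆ cthickening β Γ := closedBall_subset_cthickening hσ β
  have := (convex_closedBall σ β).norm_image_sub_le_of_norm_fderiv_le (𝕜 := ℝ) (f := q)
    (fun z hz => (hqΩ.contDiffAt (hΩ.mem_nhds (hsub (hb hz)))).differentiableAt (by norm_num))
    (fun z hz => hM z (hb hz)) (mem_closedBall_self hβ.le)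
    (y := x) (by rw [mem_closedBall, ← hxσ]; exact hx.le)
  rw [← dist_eq_norm x σ, ← hxσ] at this
  have h2 : M * infDist x Γ ≤ max M 1 * infDist x Γ := by
    gcongr
    · exact infDist_nonneg
    · exact le_max_left _ _
  have h3 := hq1 σ hσ
  have h4 := le_of_abs_le (this : |q x - q σ| ≤ _)
  linarith

theorem lin_int {E F : Type*} [NormedAddCommGroup E] [NormedSpace ℝ E] [FiniteDimensional ℝ E]
    [MeasurableSpace E] [BorelSpace E] [NormedAddCommGroup F] [NormedSpace ℝ F]
    [FiniteDimensional ℝ F] [MeasurableSpace F] [BorelSpace F]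
    (μ : Measure E) [μ.IsAddHaarMeasure] (A : E →L[ℝ] F) (R : F →L[ℝ] E)
    (hR : Function.RightInverse R A) {s : ℝ} (h1 : 1 ≤ Module.finrank ℝ F)
    (hs : s < Module.finrank ℝ F) (r : ℝ) :
    IntegrableOn (fun y => ‖A y‖ ^ (-s)) (ball 0 r) μ := by
  set L := ContinuousLinearEquiv.equivOfRightInverse A R hR with hL
  have hfst : ∀ y, (L y).1 = A y := fun y =>
    ContinuousLinearEquiv.fst_equivOfRightInverse A R hR y
  let ν : Measure (F × (A : E →ₗ[ℝ] F).ker) := Measure.addHaar.prod Measure.addHaar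
  let μ' : Measure E := ν.map L.symm
  have : μ'.IsAddHaarMeasure := L.symm.isAddHaarMeasure_map ν
  rw [Measure.isAddLeftInvariant_eq_smul μ μ']
  have hb : Bornology.IsBounded (L '' ball 0 r) :=
    L.toContinuousLinearMap.lipschitz.isBounded_image isBounded_ball
  obtain ⟨ρ, hρ⟩ := hb.subset_ball 0
  have key : IntegrableOn (fun z : F × (A : E →ₗ[ℝ] F).ker => ‖z.1‖ ^ (-s))
      (ball 0 ρ ×ˢ ball 0 ρ) ν := by
    rw [IntegrableOn, ← Measure.prod_restrict]
    have : IsFiniteMeasure ((Measure.addHaar : Measure (A : E →ₗ[ℝ] F).ker).restrict (ball 0 ρ)) :=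
      ⟨by rw [Measure.restrict_apply_univ]; exact measure_ball_lt_top⟩
    refine Integrable.comp_fst (f := fun z : F => ‖z‖ ^ (-s)) ?_ _
    refine integrableOn_ball_of_norm_le_rpow (C := 1) h1 hs (Eventually.of_forall fun x => ?_) ?_
    · rw [one_mul, Real.norm_of_nonneg (by positivity)]
    · exact (measurable_norm.pow_const _).aestronglyMeasurable
  have key2 : IntegrableOn (fun y => ‖A y‖ ^ (-s)) (ball 0 r) μ' := by
    have he : MeasurableEmbedding (L.symm : F × (A : E →ₗ[ℝ] F).ker → E) :=
      L.symm.toHomeomorph.measurableEmbedding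
    rw [he.integrableOn_map_iff]
    have : ((fun y => ‖A y‖ ^ (-s)) ∘ L.symm) =
        fun z : F × (A : E →ₗ[ℝ] F).ker => ‖z.1‖ ^ (-s) := by
      ext z
      simp only [Function.comp, ← hfst, L.apply_symm_apply]
    rw [this]
    refine key.mono_set ?_
    intro z hz
    have : z ∈ ball (0 : F × (A : E →ₗ[ℝ] F).ker) ρ := hρ ⟨L.symm z, hz, by simp⟩
    rw [show (0 : F × (A : E →ₗ[ℝ] F).ker) = (0, 0) from rfl, ← ball_prod_same] at this
    exact this
  rw [IntegrableOn, Measure.restrict_smul]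
  exact Integrable.smul_measure_nnreal key2

theorem loc_int {E F : Type*} [NormedAddCommGroup E] [NormedSpace ℝ E] [FiniteDimensional ℝ E]
    [MeasurableSpace E] [BorelSpace E] [NormedAddCommGroup F] [NormedSpace ℝ F]
    [FiniteDimensional ℝ F] [MeasurableSpace F] [BorelSpace F]
    (μ : Measure E) [μ.IsAddHaarMeasure] (f : E → F) (hf : ContDiff ℝ 1 f) (x₀ : E)
    (hsurj : Function.Surjective (fderiv ℝ f x₀))
    {s : ℝ} (h1 : 1 ≤ Module.finrank ℝ F) (hs : s < Module.finrank ℝ F) :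
    ∃ r > 0, IntegrableOn (fun y => ‖f y‖ ^ (-s)) (ball x₀ r) μ := by
  set A := fderiv ℝ f x₀ with hA
  obtain ⟨R, hR⟩ := A.exists_rightInverse_of_surjective (LinearMap.range_eq_top.2 hsurj)
  have hR' : Function.RightInverse R A := fun z => by
    simpa using congrArg (fun T : F →L[ℝ] F => T z) hR
  let Φ : E → E := fun x => x + R (f x - A x)
  have hAΦ : ∀ x, A (Φ x) = f x := fun x => by simp [Φ, hR' _]
  have hΦ : ContDiff ℝ 1 Φ := contDiff_id.add (R.contDiff.comp (hf.sub A.contDiff))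
  have hd : ∀ x, HasFDerivAt Φ (ContinuousLinearMap.id ℝ E + R ∘L (fderiv ℝ f x - A)) x := by
    intro x
    have h2 : HasFDerivAt f (fderiv ℝ f x) x := (hf.differentiable (by norm_num) x).hasFDerivAt
    exact (hasFDerivAt_id x).add (R.hasFDerivAt.comp x (h2.sub A.hasFDerivAt))
  have hd0 : fderiv ℝ Φ x₀ = ((ContinuousLinearEquiv.refl ℝ E : E ≃L[ℝ] E) : E →L[ℝ] E) := by
    rw [(hd x₀).fderiv]; ext v; simp [hA]
  have hst : HasStrictFDerivAt Φ ((ContinuousLinearEquiv.refl ℝ E : E ≃L[ℝ] E) : E →L[ℝ] E) x₀ := by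
    rw [← hd0]; exact hΦ.contDiffAt.hasStrictFDerivAt (by norm_num)
  set e := hst.toOpenPartialHomeomorph Φ
  have hsrc : e.source ∈ 𝓝 x₀ := e.open_source.mem_nhds hst.mem_toOpenPartialHomeomorph_source
  have hdet : ∀ᶠ x in 𝓝 x₀, (1 / 2 : ℝ) < |(fderiv ℝ Φ x).det| := by
    have hc : Continuous fun x => |(fderiv ℝ Φ x).det| :=
      (ContinuousLinearMap.continuous_det.comp (hΦ.continuous_fderiv (by norm_num))).abs
    apply hc.continuousAt.eventually (lt_mem_nhds _)
    show (1 / 2 : ℝ) < |(fderiv ℝ Φ x₀).det|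
    rw [hd0]
    have h6 : ((ContinuousLinearEquiv.refl ℝ E : E ≃L[ℝ] E) : E →L[ℝ] E).det = 1 :=
      LinearMap.det_id
    rw [h6]
    norm_num
  obtain ⟨r, hr, hrs⟩ := Metric.mem_nhds_iff.1 (inter_mem hsrc hdet)
  obtain ⟨r', hr', hrr'⟩ : ∃ r' > 0, r' < r := ⟨r / 2, by positivity, by linarith⟩
  have hbd : Bornology.IsBounded (Φ '' ball x₀ r') :=
    ((isCompact_closedBall x₀ r').image hΦ.continuous).isBounded.subset
      (Set.image_mono ball_subset_closedBall)
  obtain ⟨ρ, hρ⟩ := hbd.subset_ball 0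
  have hsub : ball x₀ r' ⊆ ball x₀ r := ball_subset_ball hrr'.le
  have hI : IntegrableOn (fun y => ‖A y‖ ^ (-s)) (Φ '' ball x₀ r') μ :=
    (lin_int μ A R hR' h1 hs ρ).mono_set hρ
  have hinj : Set.InjOn Φ (ball x₀ r') := by
    have := e.injOn
    exact this.mono fun x hx => (hrs (hsub hx)).1
  rw [integrableOn_image_iff_integrableOn_abs_det_fderiv_smul μ measurableSet_ball
    (fun x _ => (hΦ.differentiable (by norm_num) x).hasFDerivAt.hasFDerivWithinAt) hinj] at hI
  refine ⟨r', hr', ?_⟩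
  refine Integrable.mono' (hI.const_mul 2) ?_ ?_
  · exact (hf.continuous.measurable.norm.pow_const _).aestronglyMeasurable
  · rw [ae_restrict_iff' measurableSet_ball]
    refine Eventually.of_forall fun x hx => ?_
    have h3 := (hrs (hsub hx)).2
    simp only [hAΦ, smul_eq_mul]
    have h4 : 0 ≤ ‖f x‖ ^ (-s) := by positivity
    rw [Real.norm_of_nonneg h4]
    have h5 : (1 / 2 : ℝ) < |(fderiv ℝ Φ x).det| := h3
    nlinarith

theorem dist_int {N k : ℕ} (hk : k < N) {Γ : Set (Euc N)} (hΓ : IsSmoothSubmanifold N k Γ)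
    {s : ℝ} (hs0 : 0 < s) (hs : s < (N : ℝ) - k) :
    ∃ β > 0, IntegrableOn (fun x => infDist x Γ ^ (-s)) {x | infDist x Γ < β} volume := by
  have hloc : ∀ x₀ ∈ Γ, ∃ r > 0,
      IntegrableOn (fun x => infDist x Γ ^ (-s)) (ball x₀ r) volume := by
    intro x₀ hx₀
    obtain ⟨U, f, hU, hxU, hf, hsu, hΓU⟩ := hΓ.2.2 x₀ hx₀
    have hf1 : ContDiff ℝ 1 f := contDiff_infty.1 hf 1
    have hfr : Module.finrank ℝ (Euc (N - k)) = N - k := by simp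
    obtain ⟨r₁, hr₁, hI⟩ := loc_int (volume : Measure (Euc N)) f hf1 x₀ (hsu x₀ hxU)
      (s := s) (by rw [hfr]; omega) (by rw [hfr, Nat.cast_sub hk.le]; exact hs)
    obtain ⟨K, t, ht, hK⟩ := hf1.contDiffAt.exists_lipschitzOnWith (x := x₀)
    obtain ⟨r₂, hr₂, hsub⟩ := Metric.mem_nhds_iff.1 (inter_mem ht (hU.mem_nhds hxU))
    refine ⟨min r₁ (r₂ / 2), by positivity, ?_⟩
    have hI2 := hI.mono_set (ball_subset_ball (min_le_left r₁ (r₂ / 2)))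
    refine Integrable.mono' (hI2.const_mul ((K + 1 : ℝ) ^ s)) ?_ ?_
    · exact ((continuous_infDist_pt Γ).measurable.pow_const _).aestronglyMeasurable
    · rw [ae_restrict_iff' measurableSet_ball]
      refine Eventually.of_forall fun x hx => ?_
      rw [Real.norm_of_nonneg (Real.rpow_nonneg infDist_nonneg _)]
      have hx2 : dist x x₀ < r₂ / 2 := hx.trans_le (min_le_right _ _)
      have hxU' := hsub (show x ∈ ball x₀ r₂ by rw [mem_ball]; linarith)
      rcases (infDist_nonneg (x := x) (s := Γ)).eq_or_lt with h0 | h0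
      · rw [← h0, Real.zero_rpow (by linarith)]
        positivity
      obtain ⟨σ, hσ, hxσ⟩ := hΓ.1.exists_infDist_eq_dist hΓ.2.1 x
      have h1 : infDist x Γ ≤ dist x x₀ := infDist_le_dist_of_mem hx₀
      have hσ2 : dist σ x₀ < r₂ := by
        have := dist_triangle σ x x₀
        rw [dist_comm σ x, ← hxσ] at this
        linarith
      have hσU := hsub (mem_ball.2 hσ2)
      have hfσ : f σ = 0 := by
        have : σ ∈ Γ ∩ U := ⟨hσ, hσU.2⟩
        rw [hΓU] at this
        exact this.2
      have hle : ‖f x‖ ≤ (K + 1 : ℝ) * infDist x Γ := by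
        have := hK.dist_le_mul x hxU'.1 σ hσU.1
        rw [hfσ, dist_zero_right, ← hxσ] at this
        linarith
      have hfx : 0 < ‖f x‖ := by
        rw [norm_pos_iff]
        intro h
        have : x ∈ Γ ∩ U := by rw [hΓU]; exact ⟨hxU'.2, h⟩
        rw [infDist_zero_of_mem this.1] at h0
        exact lt_irrefl _ h0
      have hK1 : (0 : ℝ) < K + 1 := by positivity
      have h5 : ((K + 1 : ℝ) * infDist x Γ) ^ (-s) ≤ ‖f x‖ ^ (-s) :=
        Real.rpow_le_rpow_of_nonpos hfx hle (by linarith)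
      rw [Real.mul_rpow hK1.le h0.le, Real.rpow_neg hK1.le] at h5
      have h6 : 0 < (K + 1 : ℝ) ^ s := Real.rpow_pos_of_pos hK1 s
      rwa [inv_mul_le_iff₀ h6] at h5
  choose! r hr hI using hloc
  obtain ⟨T, hT, hcov⟩ := hΓ.1.elim_nhds_subcover (fun x => ball x (r x))
    (fun x hx => ball_mem_nhds x (hr x hx))
  obtain ⟨β, hβ, hsub⟩ := hΓ.1.exists_thickening_subset_open
    (isOpen_biUnion fun x _ => isOpen_ball) hcov
  refine ⟨β, hβ, ?_⟩
  have h1 : IntegrableOn (fun x => infDist x Γ ^ (-s)) (⋃ x ∈ T, ball x (r x)) volume :=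
    integrableOn_finset_iUnion.2 fun x hx => hI x (hT x hx)
  refine h1.mono_set (Set.Subset.trans ?_ hsub)
  intro x hx
  exact (mem_thickening_iff_infDist_lt hΓ.2.1).2 hx

/-- **Proposition 4.4 (sharpness).** For `1 ≤ p < (N-k+2)/(N-k-2)` and every sufficiently
small `β > 0`, there is a function `u ∈ Lᵖ(Γ_β)`, smooth and positive on `Γ_β \\ Γ`, which is
a classical supersolution of `-Δu - ((N-k-2)²/4) δ⁻² q u ≥ uᵖ` on `Γ_β \\ Γ`. -/
theorem existence_submanifold_subcritical {N k : ℕ} (hN : 4 ≤ N) (hk1 : 1 ≤ k)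
    (hk2 : k + 2 < N)
    (Γ Ω : Set (Euc N)) (hΓ : IsSmoothSubmanifold N k Γ)
    (hΩ : IsSmoothDomain Ω) (hΓΩ : Γ ⊆ Ω)
    (q : Euc N → ℝ) (hq : ContDiffOn ℝ 2 q (closure Ω))
    (hq0 : ∀ x ∈ Ω, 0 ≤ q x) (hq1 : ∀ σ ∈ Γ, q σ ≤ 1)
    (p : ℝ) (hp1 : 1 ≤ p) (hp2 : p < ((N : ℝ) - k + 2) / ((N : ℝ) - k - 2)) :
    ∃ β₁ > (0:ℝ), ∀ β, 0 < β → β < β₁ →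
      ∃ u : Euc N → ℝ,
        IntegrableOn (fun x => u x ^ p) (tube Ω Γ β) volume ∧
        ContDiffOn ℝ (⊤ : ℕ∞) u (tube Ω Γ β \ Γ) ∧
        (∀ x ∈ tube Ω Γ β \ Γ, 0 < u x) ∧
        (∀ x ∈ tube Ω Γ β \ Γ,
          u x ^ p ≤ -(lap u x) - (((N : ℝ) - k - 2) ^ 2 / 4) * distG Γ x ^ (-2 : ℝ) * q x * u x) := by
  have hkN : k ≤ N := by omega
  have hkN' : (k : ℝ) + 2 < N := by exact_mod_cast hk2
  obtain ⟨D, hD, C₀, hC₀, hDe⟩ := D_est hkN hΓ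
  obtain ⟨C₁, hC₁, β₂, hβ₂, hqe⟩ := q_lip hΓ.1 hΓ.2.1 hΩ.1 hΓΩ q hq hq1
  obtain ⟨a, ha_def⟩ : ∃ a : ℝ, a = ((N : ℝ) - k - 2) / 2 := ⟨_, rfl⟩
  have ha : 0 < a := by rw [ha_def]; linarith
  have hap : a * p < a + 2 := by
    have h1 : ((N : ℝ) - k + 2) / ((N : ℝ) - k - 2) = (a + 2) / a := by
      rw [show (N : ℝ) - k + 2 = 2 * (a + 2) by rw [ha_def]; ring,
        show (N : ℝ) - k - 2 = 2 * a by rw [ha_def]; ring]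
      exact mul_div_mul_left _ _ two_ne_zero
    rw [h1, lt_div_iff₀ ha] at hp2
    linarith
  obtain ⟨ε, hε, hε1, hεa, hεp⟩ : ∃ ε : ℝ, 0 < ε ∧ ε < 1 ∧ ε < a ∧ a * p < a + 2 - ε := by
    have h0 : 0 < min 1 (min a (a + 2 - a * p)) :=
      lt_min one_pos (lt_min ha (by linarith))
    have h1 := min_le_left (1 : ℝ) (min a (a + 2 - a * p))
    have h2 := (min_le_right (1 : ℝ) (min a (a + 2 - a * p))).trans (min_le_left _ _)
    have h3 := (min_le_right (1 : ℝ) (min a (a + 2 - a * p))).trans (min_le_right _ _)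
    exact ⟨min 1 (min a (a + 2 - a * p)) / 2, by linarith, by linarith, by linarith, by linarith⟩
  obtain ⟨C, hC_def⟩ : ∃ C : ℝ, C = max C₀ C₁ := ⟨_, rfl⟩
  have hCC₀ : C₀ ≤ C := by rw [hC_def]; exact le_max_left _ _
  have hCC₁ : C₁ ≤ C := by rw [hC_def]; exact le_max_right _ _
  have hC : 0 < C := lt_of_lt_of_le hC₀ hCC₀
  obtain ⟨β₃, hβ₃, hβ₃1, hreal⟩ := real_ineq (m := 2 * a + 2) ha hε hεa hε1 hC hp1 hεp rfl
  have hap0 : 0 < a * p := by positivity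
  obtain ⟨β₄, hβ₄, hIntD⟩ := dist_int (s := a * p) (by omega) hΓ hap0 (by
    rw [ha_def] at hap ⊢
    linarith)
  refine ⟨min β₂ (min β₃ β₄), lt_min hβ₂ (lt_min hβ₃ hβ₄), ?_⟩
  intro β hβ hββ
  have hb2 : β < β₂ := hββ.trans_le (min_le_left _ _)
  have hb3 : β < β₃ := hββ.trans_le ((min_le_right _ _).trans (min_le_left _ _))
  have hb4 : β < β₄ := hββ.trans_le ((min_le_right _ _).trans (min_le_right _ _))
  have main : ∀ x ∈ tube Ω Γ β \ Γ, 0 < infDist x Γ ∧ infDist x Γ ^ 2 / 2 ≤ D x ∧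
      0 < D x ^ (-(a / 2)) - D x ^ (-((a - ε) / 2)) ∧
      (D x ^ (-(a / 2)) - D x ^ (-((a - ε) / 2))) ^ p ≤
        -((((a / 2) * (a / 2 + 1)) * D x ^ (-(a / 2) - 2)
            - (((a - ε) / 2) * ((a - ε) / 2 + 1)) * D x ^ (-((a - ε) / 2) - 2)) *
              (∑ i, (fderiv ℝ D x (EuclideanSpace.single i 1)) ^ 2)
          + (-(a / 2) * D x ^ (-(a / 2) - 1)
            + ((a - ε) / 2) * D x ^ (-((a - ε) / 2) - 1)) * lap D x)
        - a ^ 2 * infDist x Γ ^ (-2 : ℝ) * q x *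
          (D x ^ (-(a / 2)) - D x ^ (-((a - ε) / 2))) := by
    intro x hx
    have hxβ : infDist x Γ < β := hx.1.2
    have hd0 : 0 < infDist x Γ := (hΓ.1.isClosed.notMem_iff_infDist_pos hΓ.2.1).1 hx.2
    obtain ⟨e1, e2, e3⟩ := hDe x (by linarith)
    have hmono : ∀ y : ℝ, 0 ≤ y → C₀ * y ≤ C * y := fun y hy => by gcongr
    have hr := hreal (infDist x Γ) (D x) (∑ i, (fderiv ℝ D x (EuclideanSpace.single i 1)) ^ 2)
      (lap D x) (q x) hd0 (by linarith) (e1.trans (hmono _ (by positivity)))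
      (e2.trans (hmono _ (by positivity)))
      (by
        rw [show 2 * (2 * a + 2) = 2 * ((N : ℝ) - k) by rw [ha_def]; ring]
        exact e3.trans (hmono _ hd0.le))
      (hq0 x hx.1.1)
      (by
        have h1 := hqe x (by linarith)
        have h2 : C₁ * infDist x Γ ≤ C * infDist x Γ := by gcongr
        linarith)
    exact ⟨hd0, hr.1, hr.2.2.1, hr.2.2.2⟩
  have hDpos : ∀ x ∈ tube Ω Γ β \ Γ, 0 < D x := fun x hx => by
    obtain ⟨h1, h2, -⟩ := main x hx
    exact lt_of_lt_of_le (by positivity) h2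
  have hsm : ∀ x ∈ tube Ω Γ β \ Γ, ContDiffAt ℝ (⊤ : ℕ∞)
      (fun x => D x ^ (-(a / 2)) - D x ^ (-((a - ε) / 2))) x := fun x hx =>
    (hD.contDiffAt.rpow_const_of_ne (hDpos x hx).ne').sub
      (hD.contDiffAt.rpow_const_of_ne (hDpos x hx).ne')
  have hmt : MeasurableSet (tube Ω Γ β) := by
    have h1 : IsOpen {x : Euc N | infDist x Γ < β} :=
      isOpen_lt (continuous_infDist_pt Γ) continuous_const
    exact (hΩ.1.inter h1).measurableSet
  refine ⟨fun x => D x ^ (-(a / 2)) - D x ^ (-((a - ε) / 2)), ?_, ?_, ?_, ?_⟩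
  · have hsub : tube Ω Γ β ⊆ {x | infDist x Γ < β₄} := fun x hx =>
      lt_trans (show infDist x Γ < β from hx.2) hb4
    refine Integrable.mono' ((hIntD.mono_set hsub).const_mul ((1 / 2 : ℝ) ^ (-(a * p / 2)))) ?_ ?_
    · have hDm : Measurable D := hD.continuous.measurable
      exact (((hDm.pow_const _).sub (hDm.pow_const _)).pow_const _).aestronglyMeasurable
    · rw [ae_restrict_iff' hmt]
      refine Eventually.of_forall fun x hx => ?_
      by_cases hxΓ : x ∈ Γ
      · have h0 : infDist x Γ = 0 := infDist_zero_of_mem hxΓ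
        have hD0 : D x = 0 := by
          have := (hDe x (by rw [h0]; norm_num)).1
          rw [h0] at this
          simpa using this
        have e1 : (0 : ℝ) ^ (-(a / 2)) = 0 := Real.zero_rpow (by linarith)
        have e2 : (0 : ℝ) ^ (-((a - ε) / 2)) = 0 := Real.zero_rpow (by linarith)
        have e3 : (0 : ℝ) ^ p = 0 := Real.zero_rpow (by linarith)
        simp only [hD0, e1, e2, sub_zero, e3, norm_zero]
        exact mul_nonneg (by positivity) (Real.rpow_nonneg infDist_nonneg _)
      · obtain ⟨hd0, hDd, hu, -⟩ := main x ⟨hx, hxΓ⟩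
        have hDp := hDpos x ⟨hx, hxΓ⟩
        rw [Real.norm_of_nonneg (Real.rpow_nonneg hu.le _)]
        have h1 : D x ^ (-(a / 2)) - D x ^ (-((a - ε) / 2)) ≤ D x ^ (-(a / 2)) := by
          linarith [Real.rpow_pos_of_pos hDp (-((a - ε) / 2))]
        calc (D x ^ (-(a / 2)) - D x ^ (-((a - ε) / 2))) ^ p
            ≤ (D x ^ (-(a / 2))) ^ p := Real.rpow_le_rpow hu.le h1 (by linarith)
          _ = D x ^ (-(a * p / 2)) := by
              rw [← Real.rpow_mul hDp.le]; congr 1; ring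
          _ ≤ (1 / 2 * infDist x Γ ^ 2) ^ (-(a * p / 2)) :=
              Real.rpow_le_rpow_of_nonpos (by positivity) (by linarith) (by linarith)
          _ = (1 / 2 : ℝ) ^ (-(a * p / 2)) * infDist x Γ ^ (-(a * p)) := by
              rw [Real.mul_rpow (by norm_num) (by positivity), ← Real.rpow_natCast,
                ← Real.rpow_mul hd0.le]
              congr 2
              push_cast
              ring
  · exact fun x hx => (hsm x hx).contDiffWithinAt
  · exact fun x hx => (main x hx).2.2.1
  · intro x hx
    have hl := lap_comp hD (hDpos x hx) (F_deriv (a / 2) ((a - ε) / 2)).1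
      (F_deriv (a / 2) ((a - ε) / 2)).2 (contDiffAt_infty.1 (hsm x hx) 2)
    have hm := (main x hx).2.2.2
    have hcoef : ((N : ℝ) - k - 2) ^ 2 / 4 = a ^ 2 := by rw [ha_def]; ring
    rw [hcoef]
    simp only [distG]
    rw [hl]
    exact hm
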